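/- arXiv:2401.17127 — 3 statements merged into one kernel-verified Lean document; each statement's English description precedes it below -/
import Mathlib

section
/- Fix an index i ∈ {1,…,n}, weights w_1,…,w_n ≥ 0 with Σ_j w_j = 1, and λ > 0, and set B(λ) = min(1/√λ, √d/λ). Let D = ((x_1,y_1),…,(x_n,y_n)) and D' = ((x_1',y_1'),…,(x_n',y_n')) be two datasets with x_j, x_j' ∈ [0,1]^d and y_j, y_j' ∈ [−1,1] for all j, such that (x_j, y_j) = (x_j', y_j') for every j ≠ i. Let θ̄ and θ̄' be the global minimizers over ℝ^d of the weighted ridge losses of D and D' respectively. Then ‖θ̄ − θ̄'‖₂ ≤ (2 w_i √d / λ)·(√d·B(λ) + 1). -/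
open scoped InnerProductSpace BigOperators

/-- If `b * t ≤ a * t ^ 2` for all real `t`, then the linear coefficient `b` vanishes. -/
lemma eq_zero_of_forall_mul_le_mul_sq {a b : ℝ} (h : ∀ t : ℝ, b * t ≤ a * t ^ 2) : b = 0 := by
  have hpos : 0 < |a| + 1 := by positivity
  have h1 := h (b / (|a| + 1))
  rw [div_pow, mul_div_assoc', mul_div_assoc', div_le_div_iff₀ hpos (by positivity)] at h1
  have h2 : b ^ 2 * (|a| + 1) ≤ a * b ^ 2 := by
    refine le_of_mul_le_mul_right ?_ hpos
    linarith
  nlinarith [le_abs_self a, sq_nonneg b, mul_nonneg (sub_nonneg.2 (le_abs_self a)) (sq_nonneg b)]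

/-- The first-order optimality condition for the weighted ridge loss, tested against `v`. -/
lemma weighted_ridge_first_order {ι E : Type*} [Fintype ι] [NormedAddCommGroup E]
    [InnerProductSpace ℝ E] {w : ι → ℝ} {lam : ℝ} {x : ι → E} {y : ι → ℝ} {θ₀ : E}
    (hmin : ∀ θ : E,
      (∑ j, w j * (y j - ⟪θ₀, x j⟫_ℝ) ^ 2) + lam * ‖θ₀‖ ^ 2 ≤
      (∑ j, w j * (y j - ⟪θ, x j⟫_ℝ) ^ 2) + lam * ‖θ‖ ^ 2) (v : E) :
    lam * ⟪θ₀, v⟫_ℝ = ∑ j, w j * ((y j - ⟪θ₀, x j⟫_ℝ) * ⟪v, x j⟫_ℝ) := by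
  have key : 2 * ((∑ j, w j * ((y j - ⟪θ₀, x j⟫_ℝ) * ⟪v, x j⟫_ℝ)) - lam * ⟪θ₀, v⟫_ℝ) = 0 := by
    refine eq_zero_of_forall_mul_le_mul_sq
      (a := (∑ j, w j * ⟪v, x j⟫_ℝ ^ 2) + lam * ‖v‖ ^ 2) fun t ↦ ?_
    have h := hmin (θ₀ + t • v)
    have hsum : ∑ j, w j * (y j - ⟪θ₀ + t • v, x j⟫_ℝ) ^ 2 =
        (∑ j, w j * (y j - ⟪θ₀, x j⟫_ℝ) ^ 2)
          - 2 * t * (∑ j, w j * ((y j - ⟪θ₀, x j⟫_ℝ) * ⟪v, x j⟫_ℝ))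
          + t ^ 2 * ∑ j, w j * ⟪v, x j⟫_ℝ ^ 2 := by
      rw [Finset.mul_sum, Finset.mul_sum, ← Finset.sum_sub_distrib, ← Finset.sum_add_distrib]
      refine Finset.sum_congr rfl fun j _ ↦ ?_
      rw [inner_add_left, real_inner_smul_left]
      ring
    rw [hsum, norm_add_sq_real, real_inner_smul_right, norm_smul, mul_pow, Real.norm_eq_abs,
      sq_abs] at h
    linarith
  linarith

/-- A vector with coordinates in `[0, 1]` has Euclidean norm at most `√d`. -/
lemma EuclideanSpace.norm_le_sqrt_of_mem_Icc {d : ℕ} {x : EuclideanSpace ℝ (Fin d)}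
    (hx : ∀ k, x k ∈ Set.Icc (0 : ℝ) 1) : ‖x‖ ≤ Real.sqrt d := by
  rw [EuclideanSpace.norm_eq]
  apply Real.sqrt_le_sqrt
  calc ∑ k, ‖x k‖ ^ 2 ≤ ∑ _k : Fin d, (1 : ℝ) := by
        refine Finset.sum_le_sum fun k _ ↦ ?_
        rw [Real.norm_eq_abs, sq_abs]
        exact pow_le_one₀ (hx k).1 (hx k).2
    _ = d := by simp

/-- The minimizer of the weighted ridge loss lies in the ball of radius `min (1 / √λ) (r / λ)`
when the covariates have norm at most `r` and the responses lie in `[-1, 1]`. -/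
lemma norm_weighted_ridge_minimizer_le {ι E : Type*} [Fintype ι] [NormedAddCommGroup E]
    [InnerProductSpace ℝ E] {w : ι → ℝ} (hw : ∀ j, 0 ≤ w j) (hwsum : ∑ j, w j = 1)
    {lam : ℝ} (hlam : 0 < lam) {x : ι → E} {y : ι → ℝ} {r : ℝ}
    (hx : ∀ j, ‖x j‖ ≤ r) (hy : ∀ j, y j ∈ Set.Icc (-1 : ℝ) 1) {θ₀ : E}
    (hmin : ∀ θ : E,
      (∑ j, w j * (y j - ⟪θ₀, x j⟫_ℝ) ^ 2) + lam * ‖θ₀‖ ^ 2 ≤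
      (∑ j, w j * (y j - ⟪θ, x j⟫_ℝ) ^ 2) + lam * ‖θ‖ ^ 2) :
    ‖θ₀‖ ≤ min (1 / Real.sqrt lam) (r / lam) := by
  have hy1 : ∀ j, |y j| ≤ 1 := fun j ↦ abs_le.2 (hy j)
  refine le_min ?_ ?_
  · have h := hmin 0
    have h0 : 0 ≤ ∑ j, w j * (y j - ⟪θ₀, x j⟫_ℝ) ^ 2 :=
      Finset.sum_nonneg fun j _ ↦ mul_nonneg (hw j) (sq_nonneg _)
    have h1 : ∑ j, w j * (y j) ^ 2 ≤ 1 := by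
      rw [← hwsum]
      exact Finset.sum_le_sum fun j _ ↦
        mul_le_of_le_one_right (hw j) ((sq_le_one_iff_abs_le_one _).2 (hy1 j))
    simp only [inner_zero_left, sub_zero, norm_zero] at h
    rw [le_div_iff₀ (Real.sqrt_pos.2 hlam)]
    refine abs_le_of_sq_le_sq' ?_ zero_le_one |>.2
    rw [mul_pow, Real.sq_sqrt hlam.le]
    linarith
  · have h := weighted_ridge_first_order hmin θ₀
    have hle : ∑ j, w j * ((y j - ⟪θ₀, x j⟫_ℝ) * ⟪θ₀, x j⟫_ℝ) ≤ r * ‖θ₀‖ := by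
      calc _ ≤ ∑ j, w j * (r * ‖θ₀‖) := by
            refine Finset.sum_le_sum fun j _ ↦ mul_le_mul_of_nonneg_left ?_ (hw j)
            calc (y j - ⟪θ₀, x j⟫_ℝ) * ⟪θ₀, x j⟫_ℝ
                ≤ y j * ⟪θ₀, x j⟫_ℝ := by nlinarith [sq_nonneg ⟪θ₀, x j⟫_ℝ]
              _ ≤ |y j| * |⟪θ₀, x j⟫_ℝ| := (le_abs_self _).trans (abs_mul _ _).le
              _ ≤ 1 * (‖θ₀‖ * ‖x j‖) := by
                gcongr
                exacts [hy1 j, abs_real_inner_le_norm _ _]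
              _ ≤ r * ‖θ₀‖ := by
                rw [one_mul, mul_comm]
                gcongr
                exact hx j
        _ = r * ‖θ₀‖ := by rw [← Finset.sum_mul, hwsum, one_mul]
    rw [real_inner_self_eq_norm_sq] at h
    rw [le_div_iff₀ hlam]
    rcases (norm_nonneg θ₀).eq_or_lt with h0 | h0
    · have hne : (Finset.univ : Finset ι).Nonempty := by
        by_contra hne
        simp [Finset.not_nonempty_iff_eq_empty.1 hne] at hwsum
      obtain ⟨j, _⟩ := hne
      rw [← h0, zero_mul]
      exact (norm_nonneg _).trans (hx j)
    · refine le_of_mul_le_mul_right ?_ h0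
      linarith

/-- The residual of a linear predictor of norm at most `B`, times the value of the linear
functional `v`, is controlled by the norms involved. -/
lemma abs_residual_mul_inner_le {E : Type*} [NormedAddCommGroup E] [InnerProductSpace ℝ E]
    {θ x : E} (v : E) {y r B : ℝ} (hx : ‖x‖ ≤ r) (hy : y ∈ Set.Icc (-1 : ℝ) 1) (hθ : ‖θ‖ ≤ B) :
    |(y - ⟪θ, x⟫_ℝ) * ⟪v, x⟫_ℝ| ≤ (r * B + 1) * (r * ‖v‖) := by
  have hr : 0 ≤ r := (norm_nonneg x).trans hx
  have hB : 0 ≤ B := (norm_nonneg θ).trans hθ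
  have hinner : |⟪θ, x⟫_ℝ| ≤ r * B := by
    refine (abs_real_inner_le_norm _ _).trans ?_
    rw [mul_comm]
    gcongr
  have hv : |⟪v, x⟫_ℝ| ≤ r * ‖v‖ := by
    refine (abs_real_inner_le_norm _ _).trans ?_
    rw [mul_comm]
    gcongr
  have hres : |y - ⟪θ, x⟫_ℝ| ≤ r * B + 1 := by
    have := abs_sub y ⟪θ, x⟫_ℝ
    have := abs_le.2 hy
    linarith
  rw [abs_mul]
  gcongr

/-- sensitivity bound for the weighted ridge minimizer with respect to data
point `i`: if two datasets differ only at index `i`, the minimizers satisfy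
`‖θ̄ − θ̄'‖ ≤ (2 wᵢ √d / λ)(√d B(λ) + 1)` with `B(λ) = min(1/√λ, √d/λ)`. -/
theorem weighted_ridge_sensitivity_bound
    {d n : ℕ} (i : Fin n) (w : Fin n → ℝ) (hw : ∀ j, 0 ≤ w j) (hwsum : ∑ j, w j = 1)
    (lam : ℝ) (hlam : 0 < lam)
    (x x' : Fin n → EuclideanSpace ℝ (Fin d)) (y y' : Fin n → ℝ)
    (hx : ∀ j k, x j k ∈ Set.Icc (0 : ℝ) 1) (hx' : ∀ j k, x' j k ∈ Set.Icc (0 : ℝ) 1)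
    (hy : ∀ j, y j ∈ Set.Icc (-1 : ℝ) 1) (hy' : ∀ j, y' j ∈ Set.Icc (-1 : ℝ) 1)
    (hneighbor : ∀ j, j ≠ i → x j = x' j ∧ y j = y' j)
    (θbar θbar' : EuclideanSpace ℝ (Fin d))
    (hmin : ∀ θ : EuclideanSpace ℝ (Fin d),
      (∑ j, w j * (y j - ⟪θbar, x j⟫_ℝ) ^ 2) + lam * ‖θbar‖ ^ 2 ≤
      (∑ j, w j * (y j - ⟪θ, x j⟫_ℝ) ^ 2) + lam * ‖θ‖ ^ 2)
    (hmin' : ∀ θ : EuclideanSpace ℝ (Fin d),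
      (∑ j, w j * (y' j - ⟪θbar', x' j⟫_ℝ) ^ 2) + lam * ‖θbar'‖ ^ 2 ≤
      (∑ j, w j * (y' j - ⟪θ, x' j⟫_ℝ) ^ 2) + lam * ‖θ‖ ^ 2) :
    ‖θbar - θbar'‖ ≤
      (2 * w i * Real.sqrt d / lam) *
        (Real.sqrt d * min (1 / Real.sqrt lam) (Real.sqrt d / lam) + 1) := by
  have hxn : ∀ j, ‖x j‖ ≤ Real.sqrt d := fun j ↦ EuclideanSpace.norm_le_sqrt_of_mem_Icc (hx j)
  have hxn' : ∀ j, ‖x' j‖ ≤ Real.sqrt d := fun j ↦ EuclideanSpace.norm_le_sqrt_of_mem_Icc (hx' j)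
  have hθ := norm_weighted_ridge_minimizer_le hw hwsum hlam hxn hy hmin
  have hθ' := norm_weighted_ridge_minimizer_le hw hwsum hlam hxn' hy' hmin'
  set B := min (1 / Real.sqrt lam) (Real.sqrt d / lam)
  have hB : 0 ≤ B := (norm_nonneg _).trans hθ
  set v := θbar - θbar' with hv
  have hterm := abs_le.1 (abs_residual_mul_inner_le v (hxn i) (hy i) hθ)
  have hterm' := abs_le.1 (abs_residual_mul_inner_le v (hxn' i) (hy' i) hθ')
  have hopt : lam * ‖v‖ ^ 2 =
      ∑ j, w j * ((y j - ⟪θbar, x j⟫_ℝ) * ⟪v, x j⟫_ℝ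
        - (y' j - ⟪θbar', x' j⟫_ℝ) * ⟪v, x' j⟫_ℝ) := by
    simp only [mul_sub (w _)]
    rw [Finset.sum_sub_distrib, ← weighted_ridge_first_order hmin v,
      ← weighted_ridge_first_order hmin' v, ← mul_sub, ← inner_sub_left,
      real_inner_self_eq_norm_sq]
  have hsum : ∑ j, w j * ((y j - ⟪θbar, x j⟫_ℝ) * ⟪v, x j⟫_ℝ
        - (y' j - ⟪θbar', x' j⟫_ℝ) * ⟪v, x' j⟫_ℝ) ≤
      w i * (2 * ((Real.sqrt d * B + 1) * (Real.sqrt d * ‖v‖))) := by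
    rw [← Finset.add_sum_erase _ _ (Finset.mem_univ i)]
    have hrest : ∑ j ∈ Finset.univ.erase i, w j * ((y j - ⟪θbar, x j⟫_ℝ) * ⟪v, x j⟫_ℝ
        - (y' j - ⟪θbar', x' j⟫_ℝ) * ⟪v, x' j⟫_ℝ) ≤ 0 := by
      refine Finset.sum_nonpos fun j hj ↦ mul_nonpos_of_nonneg_of_nonpos (hw j) ?_
      obtain ⟨hxj, hyj⟩ := hneighbor j (Finset.ne_of_mem_erase hj)
      rw [← hxj, ← hyj, hv, inner_sub_left]
      nlinarith [sq_nonneg (⟪θbar, x j⟫_ℝ - ⟪θbar', x j⟫_ℝ)]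
    have hi := mul_le_mul_of_nonneg_left (sub_le_sub hterm.2 hterm'.1) (hw i)
    linarith
  rcases (norm_nonneg v).eq_or_lt with h0 | h0
  · rw [← h0]
    have := hw i
    positivity
  · rw [div_mul_eq_mul_div, le_div_iff₀ hlam]
    refine le_of_mul_le_mul_right ?_ h0
    linarith
end

section
/- Fix privacy parameters ε_1,…,ε_n > 0, λ > 0, and a constant B > 0, and set w_i = ε_i / Σ_{j=1}^n ε_j for each i and η = (λ / (2√d·(B√d + 1))) · Σ_{j=1}^n ε_j. Fix an index i and let D and D' be two datasets with entries x_j, x_j' ∈ [0,1]^d and y_j, y_j' ∈ [−1,1], agreeing at every index j ≠ i. Assume that for each of D and D' the unregularized weighted least-squares objective θ ↦ Σ_j w_j (y_j − ⟨θ, x_j⟩)² attains a global minimizer of ℓ₂-norm at most B. Let θ̄ and θ̄' be the global minimizers of the weighted ridge losses (with weights w and parameter λ) of D and D'. Then for every o ∈ ℝ^d, exp(−η‖o − θ̄‖₂) ≤ exp(ε_i) · exp(−η‖o − θ̄'‖₂). -/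
open scoped InnerProductSpace BigOperators

/-- Quadratic growth of `f + lam * ‖·‖ ^ 2` around its minimizer, for convex `f`. -/
lemma ConvexOn.mul_norm_sub_sq_le_of_isMin_ridge {E : Type*} [NormedAddCommGroup E]
    [InnerProductSpace ℝ E] {f : E → ℝ} (hf : ConvexOn ℝ Set.univ f) {lam : ℝ} {a : E}
    (ha : ∀ b, f a + lam * ‖a‖ ^ 2 ≤ f b + lam * ‖b‖ ^ 2) (b : E) :
    lam * ‖b - a‖ ^ 2 ≤ f b + lam * ‖b‖ ^ 2 - (f a + lam * ‖a‖ ^ 2) := by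
  have key : ∀ t : ℝ, 0 < t → t < 1 →
      (1 - t) * (lam * ‖b - a‖ ^ 2) ≤ f b + lam * ‖b‖ ^ 2 - (f a + lam * ‖a‖ ^ 2) := by
    intro t ht ht1
    have hconv := hf.2 (Set.mem_univ a) (Set.mem_univ b) (sub_nonneg.2 ht1.le) ht.le
      (sub_add_cancel 1 t)
    have hnorm : ‖(1 - t) • a + t • b‖ ^ 2 =
        (1 - t) * ‖a‖ ^ 2 + t * ‖b‖ ^ 2 - t * (1 - t) * ‖b - a‖ ^ 2 := by
      rw [norm_add_sq_real, norm_sub_sq_real, norm_smul, norm_smul, mul_pow, mul_pow,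
        real_inner_smul_left, real_inner_smul_right, real_inner_comm a b,
        Real.norm_eq_abs, Real.norm_eq_abs, sq_abs, sq_abs]
      ring
    have hmin := ha ((1 - t) • a + t • b)
    rw [hnorm] at hmin
    simp only [smul_eq_mul] at hconv
    refine le_of_mul_le_mul_left ?_ ht
    linarith
  have hlim : Filter.Tendsto (fun t : ℝ => (1 - t) * (lam * ‖b - a‖ ^ 2))
      (nhdsWithin 0 (Set.Ioi 0)) (nhds (lam * ‖b - a‖ ^ 2)) := by
    have hcont : Continuous fun t : ℝ => (1 - t) * (lam * ‖b - a‖ ^ 2) := by fun_prop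
    simpa using (hcont.tendsto 0).mono_left nhdsWithin_le_nhds
  refine le_of_tendsto hlim ?_
  filter_upwards [Ioo_mem_nhdsGT (zero_lt_one' ℝ)] with t ht using key t ht.1 ht.2

/-- A weighted least-squares objective is convex. -/
lemma convexOn_sum_mul_sub_inner_sq {E ι : Type*} [NormedAddCommGroup E]
    [InnerProductSpace ℝ E] [Fintype ι] {w : ι → ℝ} (hw : ∀ j, 0 ≤ w j) (x : ι → E)
    (y : ι → ℝ) :
    ConvexOn ℝ Set.univ fun θ : E => ∑ j, w j * (y j - ⟪θ, x j⟫_ℝ) ^ 2 := by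
  refine ⟨convex_univ, fun a _ b _ s t hs ht hst => ?_⟩
  simp only [smul_eq_mul, Finset.mul_sum, ← Finset.sum_add_distrib]
  refine Finset.sum_le_sum fun j _ => ?_
  rw [inner_add_left, real_inner_smul_left, real_inner_smul_left]
  obtain rfl : s = 1 - t := by linarith
  have := mul_nonneg (hw j) (mul_nonneg (mul_nonneg hs ht) (sq_nonneg (⟪a, x j⟫_ℝ - ⟪b, x j⟫_ℝ)))
  linarith

/-- The minimizer of a ridge objective is no longer than any unregularized minimizer. -/
lemma norm_le_of_isMin_ridge {E : Type*} [NormedAddCommGroup E] {f : E → ℝ} {lam : ℝ}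
    (hlam : 0 < lam) {a θ₀ : E} (ha : ∀ b, f a + lam * ‖a‖ ^ 2 ≤ f b + lam * ‖b‖ ^ 2)
    (hθ₀ : ∀ b, f θ₀ ≤ f b) : ‖a‖ ≤ ‖θ₀‖ := by
  have h : lam * ‖a‖ ^ 2 ≤ lam * ‖θ₀‖ ^ 2 := by linarith [ha θ₀, hθ₀ a]
  exact (sq_le_sq₀ (norm_nonneg a) (norm_nonneg θ₀)).1 (le_of_mul_le_mul_left h hlam)

lemma EuclideanSpace.norm_le_sqrt_card_of_mem_Icc {ι : Type*} [Fintype ι]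
    {x : EuclideanSpace ℝ ι} (hx : ∀ k, x k ∈ Set.Icc (0 : ℝ) 1) :
    ‖x‖ ≤ Real.sqrt (Fintype.card ι) := by
  rw [EuclideanSpace.norm_eq]
  refine Real.sqrt_le_sqrt ?_
  calc ∑ k, ‖x k‖ ^ 2 ≤ ∑ _k : ι, (1 : ℝ) := Finset.sum_le_sum fun k _ => by
        rw [Real.norm_eq_abs, sq_abs]
        exact pow_le_one₀ (hx k).1 (hx k).2
    _ = Fintype.card ι := by simp

/-- The squared loss is Lipschitz on the ball of radius `B`. -/
lemma abs_sub_inner_sq_sub_le {E : Type*} [NormedAddCommGroup E] [InnerProductSpace ℝ E]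
    {a b x : E} {y B r : ℝ} (ha : ‖a‖ ≤ B) (hb : ‖b‖ ≤ B) (hx : ‖x‖ ≤ r) (hy : |y| ≤ 1) :
    |(y - ⟪b, x⟫_ℝ) ^ 2 - (y - ⟪a, x⟫_ℝ) ^ 2| ≤ 2 * r * (B * r + 1) * ‖b - a‖ := by
  have hr : 0 ≤ r := (norm_nonneg x).trans hx
  have hB : 0 ≤ B := (norm_nonneg a).trans ha
  have hres : ∀ c : E, ‖c‖ ≤ B → |y - ⟪c, x⟫_ℝ| ≤ B * r + 1 := fun c hc => by
    have hinner : |⟪c, x⟫_ℝ| ≤ B * r :=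
      (abs_real_inner_le_norm c x).trans (mul_le_mul hc hx (norm_nonneg x) hB)
    linarith [abs_sub y ⟪c, x⟫_ℝ]
  have hdiff : |⟪b - a, x⟫_ℝ| ≤ ‖b - a‖ * r :=
    (abs_real_inner_le_norm _ x).trans (mul_le_mul_of_nonneg_left hx (norm_nonneg _))
  have hsum : |(y - ⟪b, x⟫_ℝ) + (y - ⟪a, x⟫_ℝ)| ≤ 2 * (B * r + 1) := by
    linarith [abs_add_le (y - ⟪b, x⟫_ℝ) (y - ⟪a, x⟫_ℝ), hres a ha, hres b hb]
  calc |(y - ⟪b, x⟫_ℝ) ^ 2 - (y - ⟪a, x⟫_ℝ) ^ 2|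
      = |(y - ⟪b, x⟫_ℝ) + (y - ⟪a, x⟫_ℝ)| * |⟪b - a, x⟫_ℝ| := by
        rw [← abs_mul, ← abs_neg, inner_sub_left]
        congr 1
        ring
    _ ≤ 2 * (B * r + 1) * (‖b - a‖ * r) := mul_le_mul hsum hdiff (abs_nonneg _) (by positivity)
    _ = 2 * r * (B * r + 1) * ‖b - a‖ := by ring

/-- Stability of the weighted ridge minimizer under a change of the `i`-th data point. -/
lemma mul_norm_sub_le_of_isMin_ridge {E ι : Type*} [NormedAddCommGroup E]
    [InnerProductSpace ℝ E] [Fintype ι] {w : ι → ℝ} (hw : ∀ j, 0 ≤ w j) {lam B r : ℝ} {i : ι} {x x' : ι → E} {y y' : ι → ℝ}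
    (hx : ‖x i‖ ≤ r) (hx' : ‖x' i‖ ≤ r) (hy : |y i| ≤ 1) (hy' : |y' i| ≤ 1)
    (hneighbor : ∀ j, j ≠ i → x j = x' j ∧ y j = y' j) {a b : E} (ha : ‖a‖ ≤ B) (hb : ‖b‖ ≤ B)
    (hmin : ∀ θ : E, (∑ j, w j * (y j - ⟪a, x j⟫_ℝ) ^ 2) + lam * ‖a‖ ^ 2 ≤
      (∑ j, w j * (y j - ⟪θ, x j⟫_ℝ) ^ 2) + lam * ‖θ‖ ^ 2)
    (hmin' : ∀ θ : E, (∑ j, w j * (y' j - ⟪b, x' j⟫_ℝ) ^ 2) + lam * ‖b‖ ^ 2 ≤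
      (∑ j, w j * (y' j - ⟪θ, x' j⟫_ℝ) ^ 2) + lam * ‖θ‖ ^ 2) :
    lam * ‖b - a‖ ≤ w i * (2 * r * (B * r + 1)) := by
  have hr : 0 ≤ r := (norm_nonneg _).trans hx
  have hB : 0 ≤ B := (norm_nonneg a).trans ha
  have hgrow := (convexOn_sum_mul_sub_inner_sq hw x y).mul_norm_sub_sq_le_of_isMin_ridge hmin b
  have hgrow' :=
    (convexOn_sum_mul_sub_inner_sq hw x' y').mul_norm_sub_sq_le_of_isMin_ridge hmin' a
  rw [norm_sub_rev a b] at hgrow'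
  have hdiff : ∀ θ : E, (∑ j, w j * (y j - ⟪θ, x j⟫_ℝ) ^ 2) -
      (∑ j, w j * (y' j - ⟪θ, x' j⟫_ℝ) ^ 2) =
      w i * (y i - ⟪θ, x i⟫_ℝ) ^ 2 - w i * (y' i - ⟪θ, x' i⟫_ℝ) ^ 2 := fun θ => by
    rw [← Finset.sum_sub_distrib]
    refine Finset.sum_eq_single i (fun j _ hj => ?_) (by simp)
    rw [(hneighbor j hj).1, (hneighbor j hj).2, sub_self]
  have hlip := mul_le_mul_of_nonneg_left
    (abs_le.1 (abs_sub_inner_sq_sub_le ha hb hx hy)).2 (hw i)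
  have hlip' := mul_le_mul_of_nonneg_left
    (abs_le.1 (abs_sub_inner_sq_sub_le ha hb hx' hy')).1 (hw i)
  have hsq : lam * ‖b - a‖ * ‖b - a‖ ≤ w i * (2 * r * (B * r + 1)) * ‖b - a‖ := by
    linarith [hdiff a, hdiff b]
  rcases (norm_nonneg (b - a)).eq_or_lt with h0 | hpos
  · rw [← h0, mul_zero]
    exact mul_nonneg (hw i) (by positivity)
  · exact le_of_mul_le_mul_right hsq hpos

/-- pointwise density inequality for PDP-OP under the bounded-`θ̄₀`
assumption: with `wᵢ = εᵢ/Σⱼεⱼ` and `η = λ/(2√d(B√d + 1)) · Σⱼεⱼ`, assuming the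
unregularized weighted least-squares objectives of both neighboring datasets attain
global minimizers of norm at most `B`, the mechanism is `εᵢ`-DP w.r.t. point `i`. -/
theorem pdp_op_pointwise_density_inequality_boundedTheta
    {d n : ℕ} (ε : Fin n → ℝ) (hε : ∀ j, 0 < ε j) (lam : ℝ) (hlam : 0 < lam)
    (B : ℝ) (hB : 0 < B)
    (w : Fin n → ℝ) (hwdef : ∀ j, w j = ε j / ∑ k, ε k)
    (η : ℝ)
    (hηdef : η = lam / (2 * Real.sqrt d * (B * Real.sqrt d + 1)) * ∑ k, ε k)
    (i : Fin n)
    (x x' : Fin n → EuclideanSpace ℝ (Fin d)) (y y' : Fin n → ℝ)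
    (hx : ∀ j k, x j k ∈ Set.Icc (0 : ℝ) 1) (hx' : ∀ j k, x' j k ∈ Set.Icc (0 : ℝ) 1)
    (hy : ∀ j, y j ∈ Set.Icc (-1 : ℝ) 1) (hy' : ∀ j, y' j ∈ Set.Icc (-1 : ℝ) 1)
    (hneighbor : ∀ j, j ≠ i → x j = x' j ∧ y j = y' j)
    (hbounded : ∃ θ₀ : EuclideanSpace ℝ (Fin d), ‖θ₀‖ ≤ B ∧
      ∀ θ : EuclideanSpace ℝ (Fin d),
        (∑ j, w j * (y j - ⟪θ₀, x j⟫_ℝ) ^ 2) ≤ ∑ j, w j * (y j - ⟪θ, x j⟫_ℝ) ^ 2)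
    (hbounded' : ∃ θ₀ : EuclideanSpace ℝ (Fin d), ‖θ₀‖ ≤ B ∧
      ∀ θ : EuclideanSpace ℝ (Fin d),
        (∑ j, w j * (y' j - ⟪θ₀, x' j⟫_ℝ) ^ 2) ≤ ∑ j, w j * (y' j - ⟪θ, x' j⟫_ℝ) ^ 2)
    (θbar θbar' : EuclideanSpace ℝ (Fin d))
    (hmin : ∀ θ : EuclideanSpace ℝ (Fin d),
      (∑ j, w j * (y j - ⟪θbar, x j⟫_ℝ) ^ 2) + lam * ‖θbar‖ ^ 2 ≤
      (∑ j, w j * (y j - ⟪θ, x j⟫_ℝ) ^ 2) + lam * ‖θ‖ ^ 2)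
    (hmin' : ∀ θ : EuclideanSpace ℝ (Fin d),
      (∑ j, w j * (y' j - ⟪θbar', x' j⟫_ℝ) ^ 2) + lam * ‖θbar'‖ ^ 2 ≤
      (∑ j, w j * (y' j - ⟪θ, x' j⟫_ℝ) ^ 2) + lam * ‖θ‖ ^ 2) :
    ∀ o : EuclideanSpace ℝ (Fin d),
      Real.exp (-η * ‖o - θbar‖) ≤ Real.exp (ε i) * Real.exp (-η * ‖o - θbar'‖) := by
  intro o
  obtain ⟨θ₀, hθ₀B, hθ₀⟩ := hbounded
  obtain ⟨θ₀', hθ₀B', hθ₀'⟩ := hbounded'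
  have hS : 0 < ∑ k, ε k := Finset.sum_pos (fun j _ => hε j) ⟨i, Finset.mem_univ i⟩
  have hw : ∀ j, 0 ≤ w j := fun j => hwdef j ▸ (div_pos (hε j) hS).le
  have hnorm : ∀ {z : EuclideanSpace ℝ (Fin d)}, (∀ k, z k ∈ Set.Icc (0 : ℝ) 1) →
      ‖z‖ ≤ Real.sqrt d := fun hz => by
    simpa using EuclideanSpace.norm_le_sqrt_card_of_mem_Icc hz
  have hstab := mul_norm_sub_le_of_isMin_ridge hw (hnorm (hx i)) (hnorm (hx' i))
    (abs_le.2 (hy i)) (abs_le.2 (hy' i)) hneighbor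
    ((norm_le_of_isMin_ridge (f := fun θ => ∑ j, w j * (y j - ⟪θ, x j⟫_ℝ) ^ 2)
      hlam hmin hθ₀).trans hθ₀B)
    ((norm_le_of_isMin_ridge (f := fun θ => ∑ j, w j * (y' j - ⟪θ, x' j⟫_ℝ) ^ 2)
      hlam hmin' hθ₀').trans hθ₀B') hmin hmin'
  set C := 2 * Real.sqrt d * (B * Real.sqrt d + 1) with hC
  have hC0 : 0 ≤ C := by positivity
  have hη : 0 ≤ η := by rw [hηdef]; positivity
  have hbound : η * ‖θbar' - θbar‖ ≤ ε i := by
    rcases hC0.eq_or_lt with h0 | hpos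
    · simp [hηdef, ← h0, (hε i).le]
    · calc η * ‖θbar' - θbar‖ = (lam * ‖θbar' - θbar‖) * ((∑ k, ε k) / C) := by
            rw [hηdef]; ring
        _ ≤ (w i * C) * ((∑ k, ε k) / C) := mul_le_mul_of_nonneg_right hstab (by positivity)
        _ = ε i := by rw [hwdef]; field_simp
  have htri : ‖o - θbar'‖ ≤ ‖o - θbar‖ + ‖θbar' - θbar‖ := by
    rw [norm_sub_rev θbar' θbar]
    exact norm_sub_le_norm_sub_add_norm_sub o θbar θbar'
  rw [← Real.exp_add, Real.exp_le_exp]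
  linarith [mul_le_mul_of_nonneg_left htri hη]
end

section
/- Let x_1,…,x_n ∈ ℝ^d, w_1,…,w_n ≥ 0, λ > 0, θ* ∈ ℝ^d, and z_1,…,z_n ∈ ℝ, and set y_i = ⟨x_i, θ*⟩ + z_i. Let θ̄ be the global minimizer of the weighted ridge loss L_w(θ) = Σ_{i=1}^n w_i (y_i − ⟨θ, x_i⟩)² + λ‖θ‖₂², let Z ∈ ℝ^d be arbitrary, and set θ̂ = θ̄ + Z and M = Σ_{i=1}^n w_i x_i x_iᵀ. Then ‖θ̂ − θ*‖₂ ≤ ‖θ*‖₂ / (1 + λ_min(M)/λ) + (1/λ)·‖Σ_{i=1}^n w_i z_i x_i‖₂ + ‖Z‖₂. -/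
open scoped BigOperators

/-- The Euclidean (ℓ₂) norm of a vector in `ℝ^d`. -/
noncomputable def l2norm {d : ℕ} (v : Fin d → ℝ) : ℝ := Real.sqrt (∑ k, v k ^ 2)

open Matrix

theorem l2norm_eq_norm_toLp {d : ℕ} (v : Fin d → ℝ) : l2norm v = ‖WithLp.toLp 2 v‖ := by
  simp [l2norm, EuclideanSpace.norm_eq]

theorem l2norm_nonneg {d : ℕ} (v : Fin d → ℝ) : 0 ≤ l2norm v :=
  Real.sqrt_nonneg _

theorem l2norm_sq {d : ℕ} (v : Fin d → ℝ) : l2norm v ^ 2 = v ⬝ᵥ v := by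
  rw [l2norm, Real.sq_sqrt (Finset.sum_nonneg fun _ _ => sq_nonneg _)]
  simp [dotProduct, sq]

theorem l2norm_add_le {d : ℕ} (u v : Fin d → ℝ) : l2norm (u + v) ≤ l2norm u + l2norm v := by
  simp only [l2norm_eq_norm_toLp, WithLp.toLp_add]
  exact norm_add_le _ _

theorem l2norm_neg {d : ℕ} (v : Fin d → ℝ) : l2norm (-v) = l2norm v := by
  simp [l2norm]

theorem dotProduct_le_l2norm_mul {d : ℕ} (u v : Fin d → ℝ) :
    u ⬝ᵥ v ≤ l2norm u * l2norm v :=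
  Real.sum_mul_le_sqrt_mul_sqrt _ _ _

/-- The smallest eigenvalue bounds the quadratic form of a Hermitian matrix from below. -/
theorem iInf_eigenvalues_mul_le_dotProduct_mulVec {d : ℕ} {A : Matrix (Fin d) (Fin d) ℝ}
    (hA : A.IsHermitian) (u : Fin d → ℝ) :
    (⨅ k, hA.eigenvalues k) * (u ⬝ᵥ u) ≤ u ⬝ᵥ A *ᵥ u := by
  have parseval (v : Fin d → ℝ) :
      u ⬝ᵥ v = ∑ k, (u ⬝ᵥ ⇑(hA.eigenvectorBasis k)) * (v ⬝ᵥ ⇑(hA.eigenvectorBasis k)) := by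
    have h := hA.eigenvectorBasis.sum_inner_mul_inner (WithLp.toLp 2 u) (WithLp.toLp 2 v)
    simp only [EuclideanSpace.inner_eq_star_dotProduct, star_trivial] at h
    rw [dotProduct_comm u v, ← h]
    exact Finset.sum_congr rfl fun k _ => by rw [dotProduct_comm u]
  have hcoord (k : Fin d) : (A *ᵥ u) ⬝ᵥ ⇑(hA.eigenvectorBasis k) =
      hA.eigenvalues k * (u ⬝ᵥ ⇑(hA.eigenvectorBasis k)) := by
    have hT : Aᵀ = A := (conjTranspose_eq_transpose_of_trivial A).symm.trans hA
    have hcomm : A *ᵥ u = u ᵥ* A := by rw [← vecMul_transpose, hT]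
    rw [hcomm, ← dotProduct_mulVec, hA.mulVec_eigenvectorBasis,
      dotProduct_smul, smul_eq_mul]
  rw [parseval u, parseval (A *ᵥ u), Finset.mul_sum]
  refine Finset.sum_le_sum fun k _ => ?_
  rw [hcoord]
  have hk : (⨅ k, hA.eigenvalues k) ≤ hA.eigenvalues k :=
    ciInf_le (Set.finite_range _).bddBelow k
  nlinarith [mul_le_mul_of_nonneg_right hk (mul_self_nonneg (u ⬝ᵥ ⇑(hA.eigenvectorBasis k)))]

theorem posSemidef_sum_smul_vecMulVec {d n : ℕ} (x : Fin n → (Fin d → ℝ)) {w : Fin n → ℝ}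
    (hw : ∀ i, 0 ≤ w i) : (∑ i, w i • vecMulVec (x i) (x i)).PosSemidef :=
  posSemidef_sum _ fun i _ => by
    simpa using (posSemidef_vecMulVec_self_star (x i)).smul (hw i)

theorem dotProduct_sum_smul_vecMulVec_mulVec {d n : ℕ} (x : Fin n → (Fin d → ℝ))
    (w : Fin n → ℝ) (u : Fin d → ℝ) :
    u ⬝ᵥ (∑ i, w i • vecMulVec (x i) (x i)) *ᵥ u = ∑ i, w i * (x i ⬝ᵥ u) ^ 2 := by
  rw [sum_mulVec, dotProduct_sum]
  refine Finset.sum_congr rfl fun i _ => ?_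
  rw [smul_mulVec, vecMulVec_mulVec, dotProduct_smul, op_smul_eq_smul, dotProduct_smul,
    dotProduct_comm u]
  simp only [smul_eq_mul]
  ring

theorem eq_zero_of_forall_mul_add_mul_sq_nonneg {a b : ℝ}
    (h : ∀ t : ℝ, 0 ≤ a * t + b * t ^ 2) : a = 0 := by
  have hd := discrim_le_zero (a := b) (b := a) (c := 0) fun t => by nlinarith [h t]
  have : a ^ 2 ≤ 0 := by simpa [discrim] using hd
  exact pow_eq_zero_iff two_ne_zero |>.mp (le_antisymm this (sq_nonneg a))

/-- First-order optimality condition for a minimizer of the weighted ridge loss. -/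
theorem ridge_normal_equation {d n : ℕ} {x : Fin n → (Fin d → ℝ)} {w y : Fin n → ℝ} {lam : ℝ}
    {θ₀ : Fin d → ℝ}
    (hmin : ∀ θ : Fin d → ℝ,
      (∑ i, w i * (y i - ∑ k, θ₀ k * x i k) ^ 2) + lam * ∑ k, θ₀ k ^ 2 ≤
      (∑ i, w i * (y i - ∑ k, θ k * x i k) ^ 2) + lam * ∑ k, θ k ^ 2)
    (v : Fin d → ℝ) :
    ∑ i, w i * (y i - x i ⬝ᵥ θ₀) * (x i ⬝ᵥ v) = lam * (θ₀ ⬝ᵥ v) := by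
  have hx (θ : Fin d → ℝ) (i : Fin n) : ∑ k, θ k * x i k = x i ⬝ᵥ θ := dotProduct_comm _ _
  have hsq (θ : Fin d → ℝ) : ∑ k, θ k ^ 2 = θ ⬝ᵥ θ := by simp [dotProduct, sq]
  simp only [hx, hsq] at hmin
  have key := eq_zero_of_forall_mul_add_mul_sq_nonneg
    (a := 2 * (lam * (θ₀ ⬝ᵥ v) - ∑ i, w i * (y i - x i ⬝ᵥ θ₀) * (x i ⬝ᵥ v)))
    (b := ∑ i, w i * (x i ⬝ᵥ v) ^ 2 + lam * (v ⬝ᵥ v)) fun t => by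
      have hloss : ∑ i, w i * (y i - x i ⬝ᵥ (θ₀ + t • v)) ^ 2 =
          ∑ i, w i * (y i - x i ⬝ᵥ θ₀) ^ 2
            - 2 * t * ∑ i, w i * (y i - x i ⬝ᵥ θ₀) * (x i ⬝ᵥ v)
            + t ^ 2 * ∑ i, w i * (x i ⬝ᵥ v) ^ 2 := by
        rw [Finset.mul_sum, Finset.mul_sum, ← Finset.sum_sub_distrib, ← Finset.sum_add_distrib]
        refine Finset.sum_congr rfl fun i _ => ?_
        rw [dotProduct_add, dotProduct_smul, smul_eq_mul]
        ring
      have h := hmin (θ₀ + t • v)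
      rw [hloss] at h
      simp only [dotProduct_add, add_dotProduct, dotProduct_smul, smul_dotProduct, smul_eq_mul,
        dotProduct_comm v θ₀] at h
      linarith
  linarith

/-- deterministic accuracy decomposition for the perturbed ridge estimator:
with `yᵢ = ⟨xᵢ, θ*⟩ + zᵢ`, `θ̂ = θ̄ + Z` and `M = Σᵢ wᵢ xᵢ xᵢᵀ`,
`‖θ̂ − θ*‖ ≤ ‖θ*‖/(1 + λ_min(M)/λ) + (1/λ)‖Σᵢ wᵢ zᵢ xᵢ‖ + ‖Z‖`. -/
theorem perturbed_ridge_estimator_error_decomposition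
    {d n : ℕ} (x : Fin n → (Fin d → ℝ)) (w : Fin n → ℝ) (hw : ∀ i, 0 ≤ w i)
    (lam : ℝ) (hlam : 0 < lam) (θstar : Fin d → ℝ) (z : Fin n → ℝ)
    (y : Fin n → ℝ) (hy : ∀ i, y i = (∑ k, x i k * θstar k) + z i)
    (θbar : Fin d → ℝ)
    (hmin : ∀ θ : Fin d → ℝ,
      (∑ i, w i * (y i - ∑ k, θbar k * x i k) ^ 2) + lam * ∑ k, θbar k ^ 2 ≤
      (∑ i, w i * (y i - ∑ k, θ k * x i k) ^ 2) + lam * ∑ k, θ k ^ 2)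
    (Z : Fin d → ℝ) (θhat : Fin d → ℝ) (hθhat : θhat = θbar + Z)
    (hM : (∑ i, w i • Matrix.vecMulVec (x i) (x i)).IsHermitian) :
    l2norm (θhat - θstar) ≤
      l2norm θstar / (1 + (⨅ k, hM.eigenvalues k) / lam) +
        (1 / lam) * l2norm (∑ i, (w i * z i) • x i) + l2norm Z := by
  set μ := ⨅ k, hM.eigenvalues k
  set s := ∑ i, (w i * z i) • x i with hs
  have hμ : 0 ≤ μ := Real.iInf_nonneg (posSemidef_sum_smul_vecMulVec x hw).eigenvalues_nonneg
  obtain ⟨u, rfl⟩ : ∃ u, θbar = θstar + u := ⟨θbar - θstar, by abel⟩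
  have henergy : s ⬝ᵥ u - ∑ i, w i * (x i ⬝ᵥ u) ^ 2 = lam * (θstar ⬝ᵥ u + u ⬝ᵥ u) := by
    rw [← add_dotProduct, ← ridge_normal_equation hmin u, hs, sum_dotProduct,
      ← Finset.sum_sub_distrib]
    refine Finset.sum_congr rfl fun i _ => ?_
    rw [hy, ← dotProduct, dotProduct_add, smul_dotProduct, smul_eq_mul]
    ring
  have hcurv := iInf_eigenvalues_mul_le_dotProduct_mulVec hM u
  rw [dotProduct_sum_smul_vecMulVec_mulVec, ← l2norm_sq] at hcurv
  rw [← l2norm_sq] at henergy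
  have hsu := dotProduct_le_l2norm_mul s u
  have hθu := dotProduct_le_l2norm_mul (-θstar) u
  rw [neg_dotProduct, l2norm_neg] at hθu
  have hu : (lam + μ) * l2norm u ≤ l2norm s + lam * l2norm θstar := by
    rcases (l2norm_nonneg u).eq_or_lt with h0 | hpos
    · rw [← h0, mul_zero]
      have := l2norm_nonneg s
      have := l2norm_nonneg θstar
      positivity
    · refine le_of_mul_le_mul_right ?_ hpos
      nlinarith [mul_le_mul_of_nonneg_left hθu hlam.le]
  have hbound : l2norm u ≤ l2norm θstar / (1 + μ / lam) + (1 / lam) * l2norm s := by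
    calc l2norm u ≤ (l2norm s + lam * l2norm θstar) / (lam + μ) := by
          rw [le_div_iff₀ (by positivity)]
          linarith
      _ = l2norm θstar / (1 + μ / lam) + l2norm s / (lam + μ) := by
          field_simp
          ring
      _ ≤ l2norm θstar / (1 + μ / lam) + l2norm s / lam := by
          have := l2norm_nonneg s
          gcongr
          linarith
      _ = _ := by ring
  have hsplit : θhat - θstar = u + Z := by
    rw [hθhat]
    abel
  rw [hsplit]
  linarith [l2norm_add_le u Z]
end
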